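/- Let X and Y be complex Hilbert spaces, let (T(t))_{t≥0} be a bounded C₀-semigroup on X with generator A such that 0 lies in the resolvent set of A, and let C : D(A) → Y be a linear map for which there exists c₀ > 0 with ‖Cx‖ ≤ c₀(‖x‖ + ‖Ax‖) for all x ∈ D(A). Fix an integer n ≥ 1 and a real β > 1/2, and assume: (a) C is L²-finite-time admissible for A, i.e., there exist M₁, t₁ > 0 such that ∫₀^{t₁} ‖C T(t)x‖² dt ≤ M₁ ‖x‖² for all x ∈ D(A); (b) there exist M₀ > 0 and t₀ > 1 such that ‖T(t) A^{-n}‖ ≤ M₀ (log t)^{-β} for all t ≥ t₀, where A^{-n} := (A⁻¹)ⁿ; (c) there exists a linear map C̃ : D(A) → Y with ‖C̃ x‖ ≤ c₁(‖x‖ + ‖Ax‖) for all x ∈ D(A) and some c₁ > 0, such that C̃ x = (−1)ⁿ C(Aⁿ x) for all x ∈ D(A^{n+1}), and there exists K > 0 with ‖C̃ R(λ,A) x‖ ≤ K ‖x‖ / √(Re λ) for all λ with Re λ > 0 and all x ∈ X. Then C is L²-infinite-time admissible for A: there exists M > 0 such that ∫₀^∞ ‖C T(t)x‖² dt ≤ M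 ‖x‖² for all x ∈ D(A). (Integer-exponent case α = n of the paper's sufficient condition for L²-infinite-time admissibility, where C̃ is the extension of C(−A)ⁿ to D(A) satisfying the 2-Weiss condition.) -/

import Mathlib

open MeasureTheory

/-- Domain of the `k`-th power of an (unbounded) operator `A` with domain `D`:
`iterDom D A 0 = X` and `iterDom D A (k+1) = {x ∈ D | A x ∈ iterDom D A k}`. -/
def iterDom {X : Type*} (D : Set X) (A : X → X) : ℕ → Set X
  | 0 => Set.univ
  | k + 1 => {x ∈ D | A x ∈ iterDom D A k}

open Filter Set
open scoped Topology FourierTransform SchwartzMap ENNReal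

/-- Plancherel's theorem for integrable square-integrable functions on the line. -/
theorem eLpNorm_fourier_eq {F : Type*} [NormedAddCommGroup F] [InnerProductSpace ℂ F]
    [CompleteSpace F] {f : ℝ → F} (hf : Integrable f) (hf2 : MemLp f 2) :
    eLpNorm (𝓕 f) 2 volume = eLpNorm f 2 volume := by
  set f2 : Lp F 2 (volume : Measure ℝ) := hf2.toLp f
  have hcont : Continuous (𝓕 f) :=
    VectorFourier.fourierIntegral_continuous Real.continuous_fourierChar
      (by exact continuous_inner) hf
  have hae : ∀ᵐ x, (𝓕 f2 : Lp F 2 (volume : Measure ℝ)) x = 𝓕 f x := by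
    refine ae_eq_of_integral_contDiff_smul_eq
      ((Lp.memLp (𝓕 f2)).locallyIntegrable (by norm_num)) hcont.locallyIntegrable ?_
    intro g g_smooth g_cpt
    have hg₁ : HasCompactSupport (Complex.ofRealCLM ∘ g) := g_cpt.comp_left rfl
    have hg₂ : ContDiff ℝ (⊤ : ℕ∞) (Complex.ofRealCLM ∘ g) := by fun_prop
    set φ := hg₁.toSchwartzMap hg₂
    calc ∫ x, g x • (𝓕 f2 : Lp F 2 (volume : Measure ℝ)) x
        = ((𝓕 f2 : Lp F 2 (volume : Measure ℝ)) : 𝓢'(ℝ, F)) φ := by simp [φ]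
      _ = (f2 : 𝓢'(ℝ, F)) (𝓕 φ) := by
        rw [← Lp.fourier_toTemperedDistribution_eq, TemperedDistribution.fourier_apply]
      _ = ∫ x, (𝓕 φ) x • f x := by
        rw [Lp.toTemperedDistribution_apply]
        refine integral_congr_ae ?_
        filter_upwards [hf2.coeFn_toLp] with x hx
        rw [hx]
      _ = ∫ x, φ x • 𝓕 f x := by
        rw [SchwartzMap.fourier_coe]
        have := VectorFourier.integral_fourierIntegral_smul_eq_flip (μ := volume) (ν := volume)
          (L := innerₗ ℝ) (f := φ) (g := f)
          Real.continuous_fourierChar (by exact continuous_inner) φ.integrable hf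
        rw [flip_innerₗ] at this
        exact this
      _ = ∫ x, g x • 𝓕 f x := by simp [φ]
  rw [← eLpNorm_congr_ae hae, ← eLpNorm_congr_ae hf2.coeFn_toLp]
  have := Lp.norm_fourier_eq f2
  rwa [Lp.norm_def, Lp.norm_def, ENNReal.toReal_eq_toReal_iff' (Lp.eLpNorm_ne_top _)
    (Lp.eLpNorm_ne_top _)] at this

theorem lintegral_norm_sq_laplace {F : Type*} [NormedAddCommGroup F] [InnerProductSpace ℂ F]
    [CompleteSpace F] {g : ℝ → F} (hg : ContinuousOn g (Ici 0)) {K ε σ : ℝ}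
    (hK : ∀ t, 0 ≤ t → ‖g t‖ ≤ K * Real.exp (ε * t)) (hσ : ε < σ) :
    ∫⁻ ξ : ℝ, ‖∫ t in Ioi (0 : ℝ), Complex.exp (-(σ + (2 * Real.pi * ξ : ℝ) * Complex.I) * t) • g t‖ₑ ^ 2
      = ∫⁻ t in Ioi (0 : ℝ), ‖Complex.exp (-(σ : ℂ) * t) • g t‖ₑ ^ 2 := by
  set h : ℝ → F := fun t => Complex.exp (-(σ : ℂ) * t) • g t with h_def
  set f : ℝ → F := (Ioi (0 : ℝ)).indicator h with f_def
  have hh_cont : ContinuousOn h (Ioi 0) := by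
    refine ContinuousOn.smul (by fun_prop) (hg.mono Ioi_subset_Ici_self)
  have hh_norm : ∀ t, 0 < t → ‖h t‖ ≤ K * Real.exp (-(σ - ε) * t) := by
    intro t ht
    have h1 : ‖Complex.exp (-(σ : ℂ) * t)‖ = Real.exp (-σ * t) := by
      rw [Complex.norm_exp]; simp
    rw [h_def, norm_smul, h1]
    calc Real.exp (-σ * t) * ‖g t‖ ≤ Real.exp (-σ * t) * (K * Real.exp (ε * t)) := by
          gcongr; exact hK t ht.le
      _ = K * (Real.exp (-σ * t) * Real.exp (ε * t)) := by ring
      _ = _ := by rw [← Real.exp_add]; ring_nf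
  have hh_meas : AEStronglyMeasurable h (volume.restrict (Ioi 0)) :=
    hh_cont.aestronglyMeasurable measurableSet_Ioi
  have hh1 : IntegrableOn h (Ioi 0) := by
    refine Integrable.mono' ((integrableOn_exp_mul_Ioi (a := -(σ - ε)) (by linarith) 0).const_mul K)
      hh_meas ?_
    exact (ae_restrict_mem measurableSet_Ioi).mono fun t ht => hh_norm t ht
  have hh2 : MemLp h 2 (volume.restrict (Ioi 0)) := by
    rw [memLp_two_iff_integrable_sq_norm hh_meas]
    refine Integrable.mono' ((integrableOn_exp_mul_Ioi (a := -(2 * (σ - ε))) (by linarith) 0).const_mul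
      (K ^ 2)) (hh_meas.norm.pow 2) ?_
    refine (ae_restrict_mem measurableSet_Ioi).mono fun t ht => ?_
    rw [Real.norm_of_nonneg (by positivity)]
    calc ‖h t‖ ^ 2 ≤ (K * Real.exp (-(σ - ε) * t)) ^ 2 := by gcongr; exact hh_norm t ht
      _ = _ := by rw [mul_pow, ← Real.exp_nat_mul]; push_cast; ring_nf
  have hf1 : Integrable f := hh1.integrable_indicator measurableSet_Ioi
  have hf2 : MemLp f 2 := (memLp_indicator_iff_restrict measurableSet_Ioi).2 hh2
  have hfour : ∀ ξ : ℝ, 𝓕 f ξ =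
      ∫ t in Ioi (0 : ℝ), Complex.exp (-(σ + (2 * Real.pi * ξ : ℝ) * Complex.I) * t) • g t := by
    intro ξ
    rw [Real.fourier_eq', ← integral_indicator measurableSet_Ioi]
    congr 1
    ext t
    by_cases ht : t ∈ Ioi (0 : ℝ)
    · rw [f_def, indicator_of_mem ht, indicator_of_mem ht, h_def, smul_smul, ← Complex.exp_add]
      congr 2
      simp
      ring
    · rw [f_def, indicator_of_notMem ht, indicator_of_notMem ht, smul_zero]
  have key := eLpNorm_fourier_eq hf1 hf2
  have hsq : ∀ u : ℝ → F, eLpNorm u 2 volume ^ 2 = ∫⁻ t, ‖u t‖ₑ ^ 2 := by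
    intro u
    rw [eLpNorm_eq_lintegral_rpow_enorm_toReal (by norm_num) (by norm_num), ← ENNReal.rpow_natCast,
      ← ENNReal.rpow_mul]
    simp
  have key2 := congrArg (fun a => a ^ 2) key
  simp only [hsq] at key2
  simp_rw [hfour] at key2
  rw [key2, ← lintegral_indicator measurableSet_Ioi]
  congr 1
  ext t
  by_cases ht : t ∈ Ioi (0 : ℝ)
  · rw [f_def, indicator_of_mem ht, indicator_of_mem ht]
  · rw [f_def, indicator_of_notMem ht, indicator_of_notMem ht]; simp

theorem integral_Ioi_eq_neg_of_hasDeriv_right {F : Type*} [NormedAddCommGroup F] [NormedSpace ℝ F]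
    [CompleteSpace F] {f f' : ℝ → F} (hf : ContinuousOn f (Ici 0))
    (hf' : ∀ t, 0 < t → HasDerivWithinAt f (f' t) (Ioi t) t)
    (hint : IntegrableOn f' (Ioi 0)) (hlim : Tendsto f atTop (𝓝 0)) :
    ∫ t in Ioi (0 : ℝ), f' t = -f 0 := by
  have h1 := intervalIntegral_tendsto_integral_Ioi 0 hint tendsto_id
  have h2 : Tendsto (fun b => f b - f 0) atTop (𝓝 (0 - f 0)) := hlim.sub_const _
  rw [zero_sub] at h2
  refine tendsto_nhds_unique (h1.congr' ?_) h2
  filter_upwards [eventually_ge_atTop 0] with b hb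
  refine intervalIntegral.integral_eq_sub_of_hasDeriv_right ?_ ?_ ?_
  · exact hf.mono (by rw [id, uIcc_of_le hb]; exact Icc_subset_Ici_self)
  · intro t ht
    exact hf' t (by simpa [hb] using ht.1)
  · change IntervalIntegrable f' volume 0 b
    rw [intervalIntegrable_iff_integrableOn_Ioc_of_le hb]
    exact hint.mono_set Ioc_subset_Ioi_self

/-- A bounded `C₀`-semigroup with bound `c`. -/
structure IsBoundedSemigroup {X : Type*} [NormedAddCommGroup X] [NormedSpace ℂ X]
    (T : ℝ → X →L[ℂ] X) (c : ℝ) : Prop where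
  zero : T 0 = 1
  add : ∀ s t : ℝ, 0 ≤ s → 0 ≤ t → T (s + t) = T s ∘L T t
  cont : ∀ x : X, ContinuousOn (fun t : ℝ => T t x) (Ici 0)
  bdd : ∀ t : ℝ, 0 ≤ t → ‖T t‖ ≤ c

/-- `x` lies in the domain of the generator of `T`, which maps it to `y`. -/
def GeneratorMapsTo {X : Type*} [NormedAddCommGroup X] [NormedSpace ℂ X]
    (T : ℝ → X →L[ℂ] X) (x y : X) : Prop :=
  Tendsto (fun t : ℝ => (t : ℂ)⁻¹ • (T t x - x)) (𝓝[>] 0) (𝓝 y)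

namespace IsBoundedSemigroup

variable {X : Type*} [NormedAddCommGroup X] [NormedSpace ℂ X] {T : ℝ → X →L[ℂ] X} {c : ℝ}

theorem norm_apply_le (hT : IsBoundedSemigroup T c) {t : ℝ} (ht : 0 ≤ t) (x : X) :
    ‖T t x‖ ≤ c * ‖x‖ :=
  (T t).le_of_opNorm_le (hT.bdd t ht) x

theorem nonneg (hT : IsBoundedSemigroup T c) : 0 ≤ c :=
  (norm_nonneg _).trans (hT.bdd 0 le_rfl)

theorem generatorMapsTo_apply (hT : IsBoundedSemigroup T c) {x y : X}
    (hxy : GeneratorMapsTo T x y) {t : ℝ} (ht : 0 ≤ t) :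
    GeneratorMapsTo T (T t x) (T t y) := by
  have h := ((T t).continuous.tendsto y).comp hxy
  refine h.congr' ?_
  filter_upwards [self_mem_nhdsWithin] with s hs
  have hs : 0 ≤ s := le_of_lt hs
  have hcomm : T t (T s x) = T s (T t x) := by
    rw [← ContinuousLinearMap.comp_apply, ← ContinuousLinearMap.comp_apply,
      ← hT.add t s ht hs, ← hT.add s t hs ht, add_comm]
  simp [hcomm]

theorem hasDerivWithinAt (hT : IsBoundedSemigroup T c) {x y : X}
    (hxy : GeneratorMapsTo T x y) {t : ℝ} (ht : 0 ≤ t) :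
    HasDerivWithinAt (fun s => T s x) (T t y) (Ioi t) t := by
  rw [hasDerivWithinAt_iff_tendsto_slope' self_notMem_Ioi]
  have hshift : Tendsto (fun s => s - t) (𝓝[>] t) (𝓝[>] 0) := by
    refine tendsto_nhdsWithin_iff.2 ⟨?_, ?_⟩
    · have : Tendsto (fun s => s - t) (𝓝 t) (𝓝 (t - t)) := tendsto_id.sub_const t
      rw [sub_self] at this
      exact this.mono_left nhdsWithin_le_nhds
    · filter_upwards [self_mem_nhdsWithin] with s hs
      exact mem_Ioi.2 (sub_pos.2 (mem_Ioi.1 hs))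
  refine ((hT.generatorMapsTo_apply hxy ht).comp hshift).congr' ?_
  filter_upwards [self_mem_nhdsWithin] with s hs
  have hs' : 0 ≤ s - t := (sub_pos.2 (mem_Ioi.1 hs)).le
  have h1 : T s x = T (s - t) (T t x) := by
    rw [← ContinuousLinearMap.comp_apply, ← hT.add _ _ hs' ht, sub_add_cancel]
  rw [slope_def_module, h1, Function.comp_apply, ← Complex.ofReal_inv, Complex.coe_smul]

theorem integrableOn_exp_smul (hT : IsBoundedSemigroup T c) (x : X) {lam : ℂ} (hlam : 0 < lam.re) :
    IntegrableOn (fun t : ℝ => Complex.exp (-lam * t) • T t x) (Ioi 0) := by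
  refine Integrable.mono' ((integrableOn_exp_mul_Ioi (a := -lam.re) (by linarith) 0).const_mul
    (c * ‖x‖)) ?_ ?_
  · exact (ContinuousOn.smul (by fun_prop) ((hT.cont x).mono Ioi_subset_Ici_self)
      ).aestronglyMeasurable measurableSet_Ioi
  · refine (ae_restrict_mem measurableSet_Ioi).mono fun t ht => ?_
    rw [norm_smul, Complex.norm_exp, mul_comm (c * ‖x‖)]
    have := hT.norm_apply_le (le_of_lt ht) x
    gcongr
    simp

theorem integrableOn_mul_exp_smul (hT : IsBoundedSemigroup T c) (x : X) {lam : ℂ}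
    (hlam : 0 < lam.re) :
    IntegrableOn (fun t : ℝ => Complex.exp (-lam * t) • (t : ℂ) • T t x) (Ioi 0) := by
  refine Integrable.mono' ((integrableOn_exp_mul_Ioi (a := -(lam.re / 2)) (by linarith) 0).const_mul
    (2 / lam.re * (c * ‖x‖))) ?_ ?_
  · exact (ContinuousOn.smul (by fun_prop) (ContinuousOn.smul (by fun_prop)
      ((hT.cont x).mono Ioi_subset_Ici_self))).aestronglyMeasurable measurableSet_Ioi
  · refine (ae_restrict_mem measurableSet_Ioi).mono fun t ht => ?_
    have ht : 0 < t := ht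
    have h1 := hT.norm_apply_le ht.le x
    have h2 : t ≤ 2 / lam.re * Real.exp (lam.re / 2 * t) := by
      have := Real.add_one_le_exp (lam.re / 2 * t)
      calc t = 2 / lam.re * (lam.re / 2 * t) := by field_simp
        _ ≤ _ := by gcongr; linarith
    rw [norm_smul, norm_smul, Complex.norm_exp, Complex.norm_of_nonneg ht.le]
    have h3 : (-lam * t).re = -(lam.re / 2) * t + -(lam.re / 2 * t) := by simp; ring
    have hc := hT.nonneg
    rw [h3, Real.exp_add]
    calc Real.exp (-(lam.re / 2) * t) * Real.exp (-(lam.re / 2 * t)) * (t * ‖T t x‖)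
        ≤ Real.exp (-(lam.re / 2) * t) * Real.exp (-(lam.re / 2 * t)) *
          (2 / lam.re * Real.exp (lam.re / 2 * t) * (c * ‖x‖)) := by gcongr
      _ = 2 / lam.re * (c * ‖x‖) * Real.exp (-(lam.re / 2) * t) *
          (Real.exp (-(lam.re / 2 * t)) * Real.exp (lam.re / 2 * t)) := by ring
      _ = _ := by rw [← Real.exp_add]; simp

theorem tendsto_exp_smul (hT : IsBoundedSemigroup T c) (x : X) {lam : ℂ} (hlam : 0 < lam.re) :
    Tendsto (fun t : ℝ => Complex.exp (-lam * t) • (t : ℂ) • T t x) atTop (𝓝 0) ∧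
    Tendsto (fun t : ℝ => Complex.exp (-lam * t) • T t x) atTop (𝓝 0) := by
  have key : ∀ k : ℕ, Tendsto (fun t : ℝ => t ^ k * Real.exp (-lam.re * t) * (c * ‖x‖)) atTop (𝓝 0) := by
    intro k
    have := (tendsto_rpow_mul_exp_neg_mul_atTop_nhds_zero k lam.re hlam).mul_const (c * ‖x‖)
    simpa using this
  constructor
  · refine squeeze_zero_norm' ?_ (key 1)
    filter_upwards [eventually_ge_atTop 0] with t ht
    rw [norm_smul, norm_smul, Complex.norm_exp, Complex.norm_of_nonneg ht, pow_one]
    have := hT.norm_apply_le ht x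
    calc _ = t * Real.exp (-lam.re * t) * ‖T t x‖ := by simp; ring
      _ ≤ _ := by gcongr
  · refine squeeze_zero_norm' ?_ (key 0)
    filter_upwards [eventually_ge_atTop 0] with t ht
    rw [norm_smul, Complex.norm_exp, pow_zero, one_mul]
    have := hT.norm_apply_le ht x
    calc _ = Real.exp (-lam.re * t) * ‖T t x‖ := by simp
      _ ≤ _ := by gcongr

theorem laplace_sub [CompleteSpace X] (hT : IsBoundedSemigroup T c) {x y : X}
    (hxy : GeneratorMapsTo T x y) {lam : ℂ} (hlam : 0 < lam.re) :
    ∫ t in Ioi (0 : ℝ), Complex.exp (-lam * t) • T t (lam • x - y) = x := by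
  have h := integral_Ioi_eq_neg_of_hasDeriv_right
    (f := fun t : ℝ => Complex.exp (-lam * t) • T t x)
    (f' := fun t : ℝ => -(Complex.exp (-lam * t) • T t (lam • x - y)))
    (ContinuousOn.smul (by fun_prop) (hT.cont x)) ?_
    (hT.integrableOn_exp_smul _ hlam).neg (hT.tendsto_exp_smul x hlam).2
  · rw [integral_neg, neg_inj] at h
    simpa [hT.zero] using h
  · intro t ht
    have he : HasDerivAt (fun t : ℝ => Complex.exp (-lam * t)) (Complex.exp (-lam * t) * -lam) t := by
      have h1 : HasDerivAt (fun t : ℝ => -lam * (t : ℂ)) (-lam) t := by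
        simpa using (Complex.ofRealCLM.hasDerivAt (x := t)).const_mul (-lam)
      exact h1.cexp
    convert! he.hasDerivWithinAt.smul (hT.hasDerivWithinAt hxy ht.le) using 1
    simp only [map_sub, map_smul]
    module

theorem laplace_mul_sub [CompleteSpace X] (hT : IsBoundedSemigroup T c) {x y : X}
    (hxy : GeneratorMapsTo T x y) {lam : ℂ} (hlam : 0 < lam.re) :
    ∫ t in Ioi (0 : ℝ), Complex.exp (-lam * t) • (t : ℂ) • T t (lam • x - y)
      = ∫ t in Ioi (0 : ℝ), Complex.exp (-lam * t) • T t x := by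
  have h := integral_Ioi_eq_neg_of_hasDeriv_right
    (f := fun t : ℝ => Complex.exp (-lam * t) • (t : ℂ) • T t x)
    (f' := fun t : ℝ => Complex.exp (-lam * t) • T t x
      - Complex.exp (-lam * t) • (t : ℂ) • T t (lam • x - y))
    (ContinuousOn.smul (by fun_prop) (ContinuousOn.smul (by fun_prop) (hT.cont x))) ?_
    ((hT.integrableOn_exp_smul _ hlam).sub (hT.integrableOn_mul_exp_smul _ hlam))
    (hT.tendsto_exp_smul x hlam).1
  · rw [integral_sub (hT.integrableOn_exp_smul _ hlam) (hT.integrableOn_mul_exp_smul _ hlam)] at h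
    rw [eq_comm, ← sub_eq_zero]
    simpa using h
  · intro t ht
    have ho : HasDerivAt (fun t : ℝ => (t : ℂ)) 1 t := by
      simpa using (hasDerivAt_id t).ofReal_comp
    have he : HasDerivAt (fun t : ℝ => Complex.exp (-lam * t)) (Complex.exp (-lam * t) * -lam) t := by
      have h1 : HasDerivAt (fun t : ℝ => -lam * (t : ℂ)) (-lam) t := by
        simpa using ho.const_mul (-lam)
      exact h1.cexp
    convert! he.hasDerivWithinAt.smul
      (ho.hasDerivWithinAt.smul (hT.hasDerivWithinAt hxy ht.le)) using 1
    simp only [map_sub, map_smul, Pi.smul_apply']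
    module

end IsBoundedSemigroup

/-- If `‖B (R(λ) R(λ) y)‖ ≤ κ ‖R(λ) z‖` on a vertical line, with the resolvents written as Laplace
transforms, then the weighted `L²` norm of the orbit of `y` is controlled by that of `z`. -/
theorem IsBoundedSemigroup.lintegral_le_of_laplace_le
    {X : Type*} [NormedAddCommGroup X] [InnerProductSpace ℂ X] [CompleteSpace X]
    {Y : Type*} [NormedAddCommGroup Y] [InnerProductSpace ℂ Y] [CompleteSpace Y]
    {T : ℝ → X →L[ℂ] X} {c : ℝ} (hT : IsBoundedSemigroup T c) (B : X →L[ℂ] Y) (y z : X)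
    {σ κ : ℝ} (hσ : 0 < σ) (hκ : 0 ≤ κ)
    (h : ∀ lam : ℂ, lam.re = σ →
      ‖B (∫ t in Ioi (0 : ℝ), Complex.exp (-lam * t) • (t : ℂ) • T t y)‖
        ≤ κ * ‖∫ t in Ioi (0 : ℝ), Complex.exp (-lam * t) • T t z‖) :
    ∫⁻ t in Ioi (0 : ℝ), ‖Complex.exp (-(σ : ℂ) * t) • (t : ℂ) • B (T t y)‖ₑ ^ 2
      ≤ ENNReal.ofReal κ ^ 2 *
        ∫⁻ t in Ioi (0 : ℝ), ‖Complex.exp (-(σ : ℂ) * t) • T t z‖ₑ ^ 2 := by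
  have hBy : ContinuousOn (fun t : ℝ => (t : ℂ) • B (T t y)) (Ici 0) :=
    ContinuousOn.smul (by fun_prop) (B.continuous.comp_continuousOn (hT.cont y))
  have hBy_le : ∀ t : ℝ, 0 ≤ t →
      ‖(t : ℂ) • B (T t y)‖ ≤ 2 / σ * (‖B‖ * (c * ‖y‖)) * Real.exp (σ / 2 * t) := by
    intro t ht
    have h1 : ‖B (T t y)‖ ≤ ‖B‖ * (c * ‖y‖) :=
      B.le_opNorm_of_le (hT.norm_apply_le ht y)
    have h2 : t ≤ 2 / σ * Real.exp (σ / 2 * t) := by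
      have := Real.add_one_le_exp (σ / 2 * t)
      calc t = 2 / σ * (σ / 2 * t) := by field_simp
        _ ≤ _ := by gcongr; linarith
    rw [norm_smul, Complex.norm_of_nonneg ht]
    calc t * ‖B (T t y)‖ ≤ (2 / σ * Real.exp (σ / 2 * t)) * (‖B‖ * (c * ‖y‖)) := by gcongr
      _ = _ := by ring
  have hz_le : ∀ t : ℝ, 0 ≤ t → ‖T t z‖ ≤ c * ‖z‖ * Real.exp (0 * t) := by
    intro t ht
    simpa using hT.norm_apply_le ht z
  rw [← lintegral_norm_sq_laplace hBy hBy_le (by linarith),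
    ← lintegral_norm_sq_laplace (hT.cont z) hz_le hσ,
    ← lintegral_const_mul' _ _ (by finiteness)]
  refine lintegral_mono fun ξ => ?_
  set lam : ℂ := σ + (2 * Real.pi * ξ : ℝ) * Complex.I with lam_def
  have hre : lam.re = σ := by simp [lam_def]
  have hB : ∫ t in Ioi (0 : ℝ), Complex.exp (-lam * t) • (t : ℂ) • B (T t y)
      = B (∫ t in Ioi (0 : ℝ), Complex.exp (-lam * t) • (t : ℂ) • T t y) := by
    rw [← B.integral_comp_comm (hT.integrableOn_mul_exp_smul y (by rwa [hre]))]
    simp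
  rw [hB, ← mul_pow]
  gcongr
  rw [← ofReal_norm, ← ofReal_norm, ← ENNReal.ofReal_mul hκ]
  exact ENNReal.ofReal_le_ofReal (h lam hre)

theorem lintegral_exp_smul_sq_le {F : Type*} [NormedAddCommGroup F] [NormedSpace ℂ F]
    {u : ℝ → F} {a b s σ : ℝ} (hσ : 0 < σ) (hs : 0 ≤ s)
    (ha : ∀ t, 0 < t → ‖u t‖ ≤ a) (hb : ∀ t, s < t → ‖u t‖ ≤ b) :
    ∫⁻ t in Ioi (0 : ℝ), ‖Complex.exp (-(σ : ℂ) * t) • u t‖ₑ ^ 2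
      ≤ ENNReal.ofReal (s * a ^ 2 + b ^ 2 / (2 * σ)) := by
  have hnorm : ∀ t : ℝ, ‖Complex.exp (-(σ : ℂ) * t) • u t‖ₑ ^ 2
      = ENNReal.ofReal ((Real.exp (-σ * t) * ‖u t‖) ^ 2) := by
    intro t
    rw [← ofReal_norm, ← ENNReal.ofReal_pow (norm_nonneg _), norm_smul, Complex.norm_exp]
    simp
  simp_rw [hnorm]
  rw [← Ioc_union_Ioi_eq_Ioi hs, ENNReal.ofReal_add (by positivity) (by positivity)]
  refine (lintegral_union_le _ _ _).trans (add_le_add ?_ ?_)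
  · calc _ ≤ ∫⁻ t in Ioc 0 s, ENNReal.ofReal (a ^ 2) := by
          refine setLIntegral_mono' measurableSet_Ioc fun t ht => ENNReal.ofReal_le_ofReal ?_
          have h1 : Real.exp (-σ * t) ≤ 1 := by
            rw [Real.exp_le_one_iff]; nlinarith [ht.1]
          calc _ ≤ (1 * a) ^ 2 := by gcongr; exact ha t ht.1
            _ = _ := by ring
      _ = _ := by
          rw [setLIntegral_const, Real.volume_Ioc, sub_zero, ← ENNReal.ofReal_mul (by positivity),
            mul_comm]
  · calc _ ≤ ∫⁻ t in Ioi s, ENNReal.ofReal (b ^ 2 * Real.exp (-(2 * σ) * t)) := by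
          refine setLIntegral_mono' measurableSet_Ioi fun t ht => ENNReal.ofReal_le_ofReal ?_
          calc _ ≤ (Real.exp (-σ * t) * b) ^ 2 := by gcongr; exact hb t ht
            _ = b ^ 2 * Real.exp (-(2 * σ) * t) := by
              rw [mul_pow, ← Real.exp_nat_mul]; push_cast; ring_nf
      _ = ENNReal.ofReal (∫ t in Ioi s, b ^ 2 * Real.exp (-(2 * σ) * t)) := by
          rw [ofReal_integral_eq_lintegral_ofReal]
          · exact (integrableOn_exp_mul_Ioi (by linarith) s).const_mul _
          · exact ae_of_all _ fun t => by positivity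
      _ ≤ _ := by
          refine ENNReal.ofReal_le_ofReal ?_
          rw [integral_const_mul, integral_exp_mul_Ioi (by linarith) s]
          have h1 : Real.exp (-(2 * σ) * s) ≤ 1 := by
            rw [Real.exp_le_one_iff]; nlinarith
          rw [neg_div_neg_eq, div_eq_mul_one_div (b ^ 2)]
          gcongr

theorem lintegral_Ioc_le_of_lintegral_exp_smul_le {F : Type*} [NormedAddCommGroup F]
    [NormedSpace ℂ F] {v : ℝ → F} {τ : ℝ} (hτ : 0 < τ) {M : ℝ≥0∞}
    (h : ∫⁻ t in Ioi (0 : ℝ), ‖Complex.exp (-((1 / τ : ℝ) : ℂ) * t) • (t : ℂ) • v t‖ₑ ^ 2 ≤ M) :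
    ∫⁻ t in Ioc τ (4 * τ), ‖v t‖ₑ ^ 2 ≤ ENNReal.ofReal (Real.exp 8 / τ ^ 2) * M := by
  calc ∫⁻ t in Ioc τ (4 * τ), ‖v t‖ₑ ^ 2
      ≤ ∫⁻ t in Ioc τ (4 * τ), ENNReal.ofReal (Real.exp 8 / τ ^ 2) *
          ‖Complex.exp (-((1 / τ : ℝ) : ℂ) * t) • (t : ℂ) • v t‖ₑ ^ 2 := by
        refine setLIntegral_mono' measurableSet_Ioc fun t ht => ?_
        have ht0 : 0 < t := hτ.trans ht.1
        rw [← ofReal_norm, ← ofReal_norm, ← ENNReal.ofReal_pow (norm_nonneg _),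
          ← ENNReal.ofReal_pow (norm_nonneg _), ← ENNReal.ofReal_mul (by positivity)]
        refine ENNReal.ofReal_le_ofReal ?_
        rw [norm_smul, norm_smul, Complex.norm_exp, Complex.norm_of_nonneg ht0.le]
        have h1 : (-((1 / τ : ℝ) : ℂ) * t).re = -(t / τ) := by simp; ring
        have h2 : t / τ ≤ 4 := by rw [div_le_iff₀ hτ]; exact ht.2
        rw [h1]
        calc ‖v t‖ ^ 2 = Real.exp 8 / τ ^ 2 * (Real.exp (-4) * (τ * ‖v t‖)) ^ 2 := by
              rw [mul_pow, ← Real.exp_nat_mul, mul_pow]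
              have : Real.exp 8 * Real.exp ((2 : ℕ) * (-4)) = 1 := by
                rw [← Real.exp_add]; norm_num
              calc ‖v t‖ ^ 2 = Real.exp 8 * Real.exp ((2 : ℕ) * (-4)) * ‖v t‖ ^ 2 := by
                    rw [this, one_mul]
                _ = _ := by field_simp
          _ ≤ _ := by
              gcongr
              exact ht.1.le
    _ ≤ ∫⁻ t in Ioi (0 : ℝ), ENNReal.ofReal (Real.exp 8 / τ ^ 2) *
          ‖Complex.exp (-((1 / τ : ℝ) : ℂ) * t) • (t : ℂ) • v t‖ₑ ^ 2 :=
        lintegral_mono_set fun t ht => hτ.trans ht.1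
    _ ≤ _ := by
        rw [lintegral_const_mul' _ _ (by finiteness)]
        gcongr

theorem lintegral_Ioi_le_of_lintegral_Ioc_four_pow_le {f : ℝ → ℝ≥0∞} {k₀ : ℕ} {m : ℝ≥0∞}
    {w : ℕ → ℝ≥0∞} (h0 : ∫⁻ t in Ioc (0 : ℝ) (4 ^ k₀), f t ≤ m)
    (h : ∀ k ≥ k₀, ∫⁻ t in Ioc (4 ^ k : ℝ) (4 * 4 ^ k), f t ≤ w k) :
    ∫⁻ t in Ioi (0 : ℝ), f t ≤ m + ∑' k, w k := by
  have hcover : Ioi (0 : ℝ) ⊆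
      Ioc (0 : ℝ) (4 ^ k₀) ∪ ⋃ j : ℕ, Ioc (4 ^ (k₀ + j) : ℝ) (4 * 4 ^ (k₀ + j)) := by
    intro t ht
    rcases le_or_gt t (4 ^ k₀) with h1 | h1
    · exact Or.inl ⟨ht, h1⟩
    · right
      obtain ⟨i, hi1, hi2⟩ := exists_mem_Ioc_zpow (mem_Ioi.1 ht) (y := (4 : ℝ)) (by norm_num)
      have hi : (k₀ : ℤ) ≤ i := by
        by_contra! hlt
        have : (4 : ℝ) ^ (i + 1) ≤ 4 ^ (k₀ : ℤ) := zpow_le_zpow_right₀ (by norm_num) hlt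
        rw [zpow_natCast] at this
        linarith
      obtain ⟨j, rfl⟩ := Int.le.dest hi
      rw [← Nat.cast_add, zpow_natCast] at hi1
      rw [← Nat.cast_add, zpow_add_one₀ (by norm_num), zpow_natCast, mul_comm] at hi2
      exact mem_iUnion.2 ⟨j, hi1, hi2⟩
  refine (lintegral_mono_set hcover).trans ((lintegral_union_le _ _ _).trans ?_)
  gcongr
  refine (lintegral_iUnion_le _ _).trans ?_
  calc _ ≤ ∑' j, w (k₀ + j) := ENNReal.tsum_le_tsum fun j => h _ (by omega)
    _ ≤ _ := ENNReal.tsum_comp_le_tsum_of_injective (add_right_injective k₀) w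

theorem lintegral_Ioc_nat_mul_le {f : ℝ → ℝ≥0∞} {τ : ℝ} {m : ℝ≥0∞} (hτ : 0 ≤ τ)
    (h : ∀ s : ℝ, 0 ≤ s → ∫⁻ t in Ioc (0 : ℝ) τ, f (s + t) ≤ m) (N : ℕ) :
    ∫⁻ t in Ioc (0 : ℝ) (N * τ), f t ≤ N * m := by
  induction N with
  | zero => simp
  | succ N ih =>
    have hN : (0 : ℝ) ≤ N * τ := by positivity
    have hle : (N : ℝ) * τ ≤ (N + 1 : ℕ) * τ := by push_cast; linarith
    rw [← Ioc_union_Ioc_eq_Ioc hN hle]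
    refine (lintegral_union_le _ _ _).trans ?_
    have h1 : ∫⁻ t in Ioc (N * τ) ((N + 1 : ℕ) * τ), f t = ∫⁻ t in Ioc (0 : ℝ) τ, f (N * τ + t) := by
      rw [← (measurePreserving_add_left volume (N * τ)).setLIntegral_comp_preimage_emb
        (measurableEmbedding_addLeft _)]
      congr 2
      ext t
      simp only [mem_Ioc, mem_preimage]
      push_cast
      constructor <;> rintro ⟨h1, h2⟩ <;> constructor <;> linarith
    rw [h1]
    push_cast
    rw [add_mul, one_mul]
    exact add_le_add ih (h _ hN)

theorem iterDom_inv_pow {X : Type*} [NormedAddCommGroup X] [NormedSpace ℂ X] {D : Set X}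
    {A : X → X} {Ainv : X →L[ℂ] X} (h : ∀ x, Ainv x ∈ D ∧ A (Ainv x) = x) {u : X} (hu : u ∈ D)
    (n : ℕ) : (Ainv ^ n) u ∈ iterDom D A (n + 1) ∧ A^[n] ((Ainv ^ n) u) = u := by
  induction n with
  | zero => exact ⟨⟨hu, mem_univ _⟩, rfl⟩
  | succ n ih =>
    rw [pow_succ', mul_apply_eq_comp]
    refine ⟨⟨(h _).1, ?_⟩, ?_⟩
    · rw [(h _).2]
      exact ih.1
    · rw [Function.iterate_succ_apply, (h _).2]
      exact ih.2

/-- A relatively bounded operator composed with the inverse of the generator is bounded. -/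
theorem exists_clm_comp_inv {X Y : Type*} [NormedAddCommGroup X] [NormedSpace ℂ X]
    [NormedAddCommGroup Y] [NormedSpace ℂ Y] {D : Set X} {A : X → X} {Ainv : X →L[ℂ] X}
    (h : ∀ x, Ainv x ∈ D ∧ A (Ainv x) = x) {C : X → Y}
    (hadd : ∀ x ∈ D, ∀ y ∈ D, C (x + y) = C x + C y)
    (hsmul : ∀ (a : ℂ), ∀ x ∈ D, C (a • x) = a • C x) {c₀ : ℝ} (hc₀ : 0 ≤ c₀)
    (hbdd : ∀ x ∈ D, ‖C x‖ ≤ c₀ * (‖x‖ + ‖A x‖)) :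
    ∃ B : X →L[ℂ] Y, ∀ z, B z = C (Ainv z) := by
  let L : X →ₗ[ℂ] Y :=
    { toFun := fun z => C (Ainv z)
      map_add' := fun x y => by rw [map_add, hadd _ (h x).1 _ (h y).1]
      map_smul' := fun a x => by rw [map_smul, hsmul _ _ (h x).1, RingHom.id_apply] }
  refine ⟨L.mkContinuous (c₀ * (‖Ainv‖ + 1)) fun z => ?_, fun z => rfl⟩
  refine (hbdd _ (h z).1).trans ?_
  rw [(h z).2, mul_assoc]
  gcongr
  linarith [Ainv.le_opNorm z]

theorem summable_dyadic_weights (p q : ℝ) {β : ℝ} (hβ : 1 / 2 < β) :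
    Summable fun k : ℕ => p * (1 / 2 : ℝ) ^ k + q * (k : ℝ) ^ (-(2 * β)) := by
  refine (summable_geometric_two.mul_left p).add (Summable.mul_left q ?_)
  exact Real.summable_nat_rpow.2 (by linarith)

/-- For a bounded C₀-semigroup on a Hilbert space `X` with generator `A`,
`0 ∈ ρ(A)`, and a relatively `A`-bounded `C : D(A) → Y`, assume: (a) `C` is
`L²`-finite-time admissible; (b) `‖T(t)A^{-n}‖ ≤ M₀ (log t)^{-β}` for large `t`, with
`β > 1/2`; (c) `C(−A)ⁿ` extends to a relatively `A`-bounded `C̃ : D(A) → Y` satisfying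
the 2-Weiss condition `‖C̃ R(λ,A)x‖ ≤ K‖x‖/√(Re λ)`.  Then `C` is `L²`-infinite-time
admissible for `A`. -/
theorem stmt_18
    {X : Type*} [NormedAddCommGroup X] [InnerProductSpace ℂ X] [CompleteSpace X]
    {Y : Type*} [NormedAddCommGroup Y] [InnerProductSpace ℂ Y] [CompleteSpace Y]
    (T : ℝ → X →L[ℂ] X)
    (hT0 : T 0 = 1)
    (hTsemi : ∀ s t : ℝ, 0 ≤ s → 0 ≤ t → T (s + t) = T s ∘L T t)
    (hTcont : ∀ x : X, ContinuousOn (fun t : ℝ => T t x) (Set.Ici 0))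
    (hTbdd : ∃ c : ℝ, ∀ t : ℝ, 0 ≤ t → ‖T t‖ ≤ c)
    (Dom : Set X) (A : X → X)
    (hgen : ∀ x y, (x ∈ Dom ∧ A x = y) ↔
      Filter.Tendsto (fun t : ℝ => (t : ℂ)⁻¹ • (T t x - x))
        (nhdsWithin 0 (Set.Ioi 0)) (nhds y))
    (Ainv : X →L[ℂ] X)
    (hAinv₁ : ∀ x, Ainv x ∈ Dom ∧ A (Ainv x) = x)
    (hAinv₂ : ∀ x ∈ Dom, Ainv (A x) = x)
    (R : ℂ → X →L[ℂ] X)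
    (hR₁ : ∀ lam : ℂ, 0 < lam.re → ∀ x, R lam x ∈ Dom ∧ lam • R lam x - A (R lam x) = x)
    (hR₂ : ∀ lam : ℂ, 0 < lam.re → ∀ x ∈ Dom, R lam (lam • x - A x) = x)
    (C : X → Y)
    (hCadd : ∀ x ∈ Dom, ∀ y ∈ Dom, C (x + y) = C x + C y)
    (hCsmul : ∀ (a : ℂ), ∀ x ∈ Dom, C (a • x) = a • C x)
    (hCbdd : ∃ c₀ > 0, ∀ x ∈ Dom, ‖C x‖ ≤ c₀ * (‖x‖ + ‖A x‖))
    (n : ℕ) (hn : 1 ≤ n) (β : ℝ) (hβ : 1 / 2 < β)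
    -- (a) L²-finite-time admissibility of C
    (hfin : ∃ M₁ > 0, ∃ t₁ > 0, ∀ x ∈ Dom,
      (∫⁻ t in Set.Ioc (0 : ℝ) t₁, ENNReal.ofReal (‖C (T t x)‖ ^ 2))
        ≤ ENNReal.ofReal (M₁ * ‖x‖ ^ 2))
    -- (b) logarithmic decay of ‖T(t)A^{-n}‖
    (hlog : ∃ M₀ > 0, ∃ t₀ > 1, ∀ t : ℝ, t₀ ≤ t →
      ‖(T t) ∘L (Ainv ^ n)‖ ≤ M₀ * Real.log t ^ (-β))
    -- (c) the strong 2-Weiss condition: C̃ extends C(−A)ⁿ and satisfies the 2-Weiss condition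
    (Ct : X → Y)
    (hCtadd : ∀ x ∈ Dom, ∀ y ∈ Dom, Ct (x + y) = Ct x + Ct y)
    (hCtsmul : ∀ (a : ℂ), ∀ x ∈ Dom, Ct (a • x) = a • Ct x)
    (hCtbdd : ∃ c₁ > 0, ∀ x ∈ Dom, ‖Ct x‖ ≤ c₁ * (‖x‖ + ‖A x‖))
    (hCtext : ∀ x ∈ iterDom Dom A (n + 1), Ct x = ((-1 : ℂ) ^ n) • C (A^[n] x))
    (hWeiss : ∃ K > 0, ∀ lam : ℂ, 0 < lam.re → ∀ x : X,
      ‖Ct (R lam x)‖ ≤ K * ‖x‖ / Real.sqrt lam.re) :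
    ∃ M > 0, ∀ x ∈ Dom,
      (∫⁻ t in Set.Ioi (0 : ℝ), ENNReal.ofReal (‖C (T t x)‖ ^ 2))
        ≤ ENNReal.ofReal (M * ‖x‖ ^ 2) := by
  obtain ⟨c, hc⟩ := hTbdd
  have hT : IsBoundedSemigroup T c := ⟨hT0, hTsemi, hTcont, hc⟩
  have hAgen : ∀ x ∈ Dom, GeneratorMapsTo T x (A x) := fun x hx => (hgen x (A x)).1 ⟨hx, rfl⟩
  have horbit : ∀ x ∈ Dom, ∀ t : ℝ, 0 ≤ t → T t x ∈ Dom ∧ A (T t x) = T t (A x) := fun x hx t ht =>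
    (hgen _ _).2 (hT.generatorMapsTo_apply (hAgen x hx) ht)
  obtain ⟨c₀, hc₀, hCbdd⟩ := hCbdd
  obtain ⟨B, hB⟩ := exists_clm_comp_inv hAinv₁ hCadd hCsmul hc₀.le hCbdd
  have hCB : ∀ x ∈ Dom, ∀ t : ℝ, 0 ≤ t → C (T t x) = B (T t (A x)) := by
    intro x hx t ht
    rw [hB, ← (horbit x hx t ht).2, hAinv₂ _ (horbit x hx t ht).1]
  have hlap : ∀ lam : ℂ, 0 < lam.re → ∀ w,
      ∫ t in Ioi (0 : ℝ), Complex.exp (-lam * t) • T t w = R lam w := by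
    intro lam hlam w
    have h := hT.laplace_sub (hAgen _ (hR₁ lam hlam w).1) hlam
    rwa [(hR₁ lam hlam w).2] at h
  have hlap' : ∀ lam : ℂ, 0 < lam.re → ∀ w,
      ∫ t in Ioi (0 : ℝ), Complex.exp (-lam * t) • (t : ℂ) • T t w = R lam (R lam w) := by
    intro lam hlam w
    have h := hT.laplace_mul_sub (hAgen _ (hR₁ lam hlam w).1) hlam
    rwa [(hR₁ lam hlam w).2, hlap lam hlam] at h
  have hcomm : ∀ lam : ℂ, 0 < lam.re → ∀ w, R lam (Ainv w) = Ainv (R lam w) := by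
    intro lam hlam w
    have h := hR₂ lam hlam (Ainv (R lam w)) (hAinv₁ _).1
    rw [(hAinv₁ _).2] at h
    have h2 := congrArg Ainv (hR₁ lam hlam w).2
    rw [map_sub, map_smul, hAinv₂ _ (hR₁ lam hlam w).1] at h2
    rwa [h2] at h
  have hcomm_pow : ∀ lam : ℂ, 0 < lam.re → ∀ w (k : ℕ),
      R lam ((Ainv ^ k) w) = (Ainv ^ k) (R lam w) := by
    intro lam hlam w k
    induction k with
    | zero => simp
    | succ k ih =>
      rw [pow_succ', mul_apply_eq_comp, mul_apply_eq_comp, hcomm lam hlam, ih]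
  obtain ⟨K, hK, hWeiss⟩ := hWeiss
  have hresolvent : ∀ x ∈ Dom, ∀ lam : ℂ, 0 < lam.re →
      ‖B (R lam (R lam (A x)))‖ ≤ K / Real.sqrt lam.re * ‖R lam ((Ainv ^ n) x)‖ := by
    intro x hx lam hlam
    have h1 : B (R lam (R lam (A x))) = C (R lam (R lam x)) := by
      rw [hB, ← hcomm lam hlam, ← hcomm lam hlam, hAinv₂ x hx]
    have hD := iterDom_inv_pow hAinv₁ (hR₁ lam hlam (R lam x)).1 n
    have h2 := hCtext _ hD.1
    rw [hD.2, ← hcomm_pow lam hlam, ← hcomm_pow lam hlam] at h2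
    have h3 := hWeiss lam hlam (R lam ((Ainv ^ n) x))
    rw [h2, norm_smul, norm_pow, norm_neg, norm_one, one_pow, one_mul] at h3
    rw [h1]
    exact h3.trans_eq (by ring)
  obtain ⟨M₁, hM₁, t₁, ht₁, hfin⟩ := hfin
  obtain ⟨M₀, hM₀, t₀, ht₀, hlog⟩ := hlog
  obtain ⟨k₀, hk₀⟩ : ∃ k₀ : ℕ, t₀ ≤ 2 ^ k₀ := by
    obtain ⟨k, hk⟩ := pow_unbounded_of_one_lt t₀ (one_lt_two (α := ℝ))
    exact ⟨k, hk.le⟩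
  obtain ⟨N, hN⟩ := exists_nat_ge ((4 : ℝ) ^ k₀ / t₁)
  rw [div_le_iff₀ ht₁] at hN
  set a := c * ‖Ainv ^ n‖ with a_def
  set W : ℕ → ℝ := fun k => Real.exp 8 * K ^ 2 * a ^ 2 * (1 / 2 : ℝ) ^ k +
    Real.exp 8 * K ^ 2 * (M₀ ^ 2 * Real.log 2 ^ (-(2 * β)) / 2) * (k : ℝ) ^ (-(2 * β)) with W_def
  have hWsum : Summable W := summable_dyadic_weights _ _ hβ
  have hlog2 : 0 < Real.log 2 := Real.log_pos one_lt_two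
  have hW0 : ∀ k, 0 ≤ W k := fun k => by positivity
  refine ⟨N * (M₁ * c ^ 2) + ∑' k, W k + 1,
    by have : 0 ≤ ∑' k, W k := tsum_nonneg hW0; positivity, fun x hx => ?_⟩
  have hinit : ∫⁻ t in Ioc (0 : ℝ) (4 ^ k₀), ENNReal.ofReal (‖C (T t x)‖ ^ 2)
      ≤ N * ENNReal.ofReal (M₁ * (c * ‖x‖) ^ 2) := by
    refine (lintegral_mono_set (Ioc_subset_Ioc_right hN)).trans
      (lintegral_Ioc_nat_mul_le ht₁.le (fun s hs => ?_) N)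
    calc ∫⁻ t in Ioc (0 : ℝ) t₁, ENNReal.ofReal (‖C (T (s + t) x)‖ ^ 2)
        = ∫⁻ t in Ioc (0 : ℝ) t₁, ENNReal.ofReal (‖C (T t (T s x))‖ ^ 2) := by
          refine setLIntegral_congr_fun measurableSet_Ioc fun t ht => ?_
          rw [add_comm, hTsemi t s ht.1.le hs, ContinuousLinearMap.comp_apply]
      _ ≤ ENNReal.ofReal (M₁ * ‖T s x‖ ^ 2) := hfin _ (horbit x hx s hs).1
      _ ≤ _ := by
          refine ENNReal.ofReal_le_ofReal ?_
          have := hT.norm_apply_le hs x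
          gcongr
  have hblock : ∀ k ≥ k₀, ∫⁻ t in Ioc (4 ^ k : ℝ) (4 * 4 ^ k), ENNReal.ofReal (‖C (T t x)‖ ^ 2)
      ≤ ENNReal.ofReal (W k * ‖x‖ ^ 2) := by
    intro k hk
    have hτ : (0 : ℝ) < 4 ^ k := by positivity
    have hσ : (0 : ℝ) < 1 / 4 ^ k := by positivity
    have h2k : t₀ ≤ 2 ^ k := hk₀.trans (pow_le_pow_right₀ one_le_two hk)
    have hkpos : 0 < k := by
      rcases Nat.eq_zero_or_pos k with rfl | h
      · rw [pow_zero] at h2k; linarith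
      · exact h
    have hkR : (0 : ℝ) < k := by exact_mod_cast hkpos
    have hna : ∀ t : ℝ, 0 < t → ‖T t ((Ainv ^ n) x)‖ ≤ a * ‖x‖ := by
      intro t ht
      refine (hT.norm_apply_le ht.le _).trans ?_
      rw [a_def, mul_assoc]
      have := hT.nonneg
      gcongr
      exact (Ainv ^ n).le_opNorm x
    have hnb : ∀ t : ℝ, 2 ^ k < t →
        ‖T t ((Ainv ^ n) x)‖ ≤ M₀ * (k * Real.log 2) ^ (-β) * ‖x‖ := by
      intro t ht
      have h1 : k * Real.log 2 ≤ Real.log t := by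
        rw [← Real.log_pow]
        exact Real.log_le_log (by positivity) ht.le
      have h2 : Real.log t ^ (-β) ≤ (k * Real.log 2) ^ (-β) :=
        Real.rpow_le_rpow_of_nonpos (by positivity) h1 (by linarith)
      refine ((T t) ∘L (Ainv ^ n)).le_of_opNorm_le ((hlog t (h2k.trans ht.le)).trans ?_) x
      gcongr
    have hweighted := hT.lintegral_le_of_laplace_le B (A x) ((Ainv ^ n) x) hσ
      (κ := K / Real.sqrt (1 / 4 ^ k)) (by positivity) (fun lam hlam => by
        have hre : 0 < lam.re := hlam ▸ hσ
        rw [hlap lam hre, hlap' lam hre, ← hlam]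
        exact hresolvent x hx lam hre)
    have hexp := lintegral_exp_smul_sq_le hσ (by positivity) hna hnb
    have hmain := lintegral_Ioc_le_of_lintegral_exp_smul_le hτ
      (hweighted.trans (mul_le_mul_right hexp _))
    calc ∫⁻ t in Ioc (4 ^ k : ℝ) (4 * 4 ^ k), ENNReal.ofReal (‖C (T t x)‖ ^ 2)
        = ∫⁻ t in Ioc (4 ^ k : ℝ) (4 * 4 ^ k), ‖B (T t (A x))‖ₑ ^ 2 := by
          refine setLIntegral_congr_fun measurableSet_Ioc fun t ht => ?_
          rw [hCB x hx t (hτ.trans ht.1).le, ENNReal.ofReal_pow (norm_nonneg _), ofReal_norm]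
      _ ≤ _ := hmain
      _ = ENNReal.ofReal (W k * ‖x‖ ^ 2) := by
          rw [← ENNReal.ofReal_pow (by positivity), ← ENNReal.ofReal_mul (by positivity),
            ← ENNReal.ofReal_mul (by positivity)]
          congr 1
          have h4 : (4 : ℝ) ^ k = 2 ^ k * 2 ^ k := by rw [← mul_pow]; norm_num
          have hpow : ((k * Real.log 2) ^ (-β)) ^ 2
              = Real.log 2 ^ (-(2 * β)) * (k : ℝ) ^ (-(2 * β)) := by
            rw [← Real.rpow_natCast, ← Real.rpow_mul (by positivity),
              Real.mul_rpow hkR.le hlog2.le]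
            push_cast
            ring_nf
          rw [W_def, div_pow, Real.sq_sqrt hσ.le, mul_pow a, mul_pow (M₀ * (k * Real.log 2) ^ (-β)),
            mul_pow M₀, hpow, h4]
          beta_reduce
          rw [one_div_pow]
          field_simp
  refine (lintegral_Ioi_le_of_lintegral_Ioc_four_pow_le hinit hblock).trans ?_
  rw [← ENNReal.ofReal_tsum_of_nonneg (fun k => mul_nonneg (hW0 k) (by positivity))
    (hWsum.mul_right _), tsum_mul_right, ← ENNReal.ofReal_natCast,
    ← ENNReal.ofReal_mul (by positivity), ← ENNReal.ofReal_add (by positivity)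
      (mul_nonneg (tsum_nonneg hW0) (by positivity))]
  refine ENNReal.ofReal_le_ofReal ?_
  nlinarith [sq_nonneg ‖x‖]
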